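/- Let X be a real 2n×2n matrix such that the matrix Y = -X·J·Xᵀ·J has no zero and no negative real eigenvalues (i.e. no real number t ≤ 0 lies in the spectrum of Y). Then there exists a real skew-Hamiltonian matrix M (i.e. (J·M)ᵀ = -J·M) satisfying M² = Y and a real symplectic matrix S (S·J·Sᵀ = J) such that X = M·S. -/

import Mathlib

open Matrix

/-- The standard symplectic form matrix `J = [[0, -I_n], [I_n, 0]]`. -/
def symplJ (n : ℕ) : Matrix (Fin n ⊕ Fin n) (Fin n ⊕ Fin n) ℝ :=
  Matrix.fromBlocks 0 (-1) 1 0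

/-- The block diagonal matrix `D = [[I_n, 0], [0, -I_n]]`. -/
def Dmat (n : ℕ) : Matrix (Fin n ⊕ Fin n) (Fin n ⊕ Fin n) ℝ :=
  Matrix.fromBlocks 1 0 0 (-1)

open Polynomial

/-- A conjugation-equivariant function on a finite
conjugation-invariant set of complex numbers is interpolated by a real polynomial. -/
theorem exists_real_polynomial_aeval_eq (s : Finset ℂ) (f : ℂ → ℂ)
    (hs : ∀ z ∈ s, (starRingEnd ℂ) z ∈ s)
    (hf : ∀ z ∈ s, f ((starRingEnd ℂ) z) = (starRingEnd ℂ) (f z)) :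
    ∃ p : ℝ[X], ∀ z ∈ s, aeval z p = f z := by
  set P : ℂ[X] := Lagrange.interpolate s id f with hP
  have hPz : ∀ z ∈ s, P.eval z = f z := fun z hz =>
    Lagrange.eval_interpolate_at_node f (Set.injOn_id _) hz
  have hlift : C (2⁻¹ : ℂ) * (P + P.map (starRingEnd ℂ)) ∈ lifts (algebraMap ℝ ℂ) := by
    rw [lifts_iff_coeff_lifts]
    intro i
    refine ⟨(P.coeff i).re, ?_⟩
    rw [coeff_C_mul, coeff_add, coeff_map, Complex.add_conj]
    simp
  obtain ⟨p, hp⟩ := (mem_lifts _).1 hlift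
  refine ⟨p, fun z hz => ?_⟩
  have hconj : (P.map (starRingEnd ℂ)).eval z = f z := by
    have h := eval_map_apply (p := P) (starRingEnd ℂ) ((starRingEnd ℂ) z)
    rw [Complex.conj_conj, hPz _ (hs z hz), hf z hz, Complex.conj_conj] at h
    exact h
  rw [← eval_map_algebraMap, hp, eval_mul, eval_C, eval_add, hPz z hz, hconj]
  ring

theorem Polynomial.Monic.exists_dvd_pow_of_aeval_eq_zero {k K : Type*} [Field k] [Field K]
    [Algebra k K] [IsAlgClosed K] {q f : k[X]} (hq : q.Monic)
    (h : ∀ z : K, aeval z q = 0 → aeval z f = 0) : ∃ N : ℕ, q ∣ f ^ N := by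
  set r := (q.map (algebraMap k K)).roots with hr
  refine ⟨Multiset.card r, ?_⟩
  rw [← map_dvd_map' (algebraMap k K), Polynomial.map_pow,
    ← prod_multiset_X_sub_C_of_monic_of_roots_card_eq (hq.map (algebraMap k K))
      (splits_iff_card_roots.1 (IsAlgClosed.splits _)), ← hr,
    ← Multiset.prod_replicate, ← Multiset.map_const']
  refine Multiset.prod_dvd_prod_of_dvd _ _ fun z hz => ?_
  rw [dvd_iff_isRoot, IsRoot, eval_map_algebraMap]
  refine h z ?_
  rw [← eval_map_algebraMap]
  exact isRoot_of_mem_roots hz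

theorem Matrix.aeval_transpose {m R : Type*} [Fintype m] [DecidableEq m] [CommRing R]
    (Y : Matrix m m R) (g : R[X]) : aeval Yᵀ g = (aeval Y g)ᵀ := by
  induction g using Polynomial.induction_on' with
  | add p q hp hq => simp [hp, hq]
  | monomial n c => simp [aeval_monomial, ← Algebra.smul_def, transpose_pow]

/-- A monic real polynomial without roots in `(-∞, 0]` divides `g ^ 2 - X` for some `g`. -/
theorem Polynomial.Monic.exists_dvd_sq_sub_X {q : ℝ[X]} (hq : q.Monic)
    (h : ∀ t : ℝ, t ≤ 0 → ¬ q.IsRoot t) : ∃ g : ℝ[X], q ∣ g ^ 2 - X := by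
  have hroot : ∀ z : ℂ, aeval z q = 0 → z.arg ≠ Real.pi := by
    intro z hz harg
    rw [Complex.arg_eq_pi_iff] at harg
    have hzr : z = algebraMap ℝ ℂ z.re := Complex.ext (by simp) (by simp [harg.2])
    rw [hzr, aeval_algebraMap_apply] at hz
    exact h z.re harg.1.le (by simpa using hz)
  obtain ⟨p, hp⟩ := exists_real_polynomial_aeval_eq (q.rootSet ℂ).toFinset
    (fun z => z ^ ((2 : ℕ)⁻¹ : ℂ))
    (fun z hz => by
      rw [Set.mem_toFinset, mem_rootSet_of_ne hq.ne_zero] at hz ⊢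
      rw [aeval_conj, hz, map_zero])
    (fun z hz => by
      rw [Set.mem_toFinset, mem_rootSet_of_ne hq.ne_zero] at hz
      simp [Complex.conj_cpow z _ (hroot z hz), map_ofNat])
  obtain ⟨N, hN⟩ : ∃ N : ℕ, q ∣ (p ^ 2 - X) ^ N := by
    refine hq.exists_dvd_pow_of_aeval_eq_zero (K := ℂ) fun z hz => ?_
    rw [map_sub, map_pow, aeval_X,
      hp z (by rwa [Set.mem_toFinset, mem_rootSet_of_ne hq.ne_zero]),
      Complex.cpow_nat_inv_pow z two_ne_zero, sub_self]
  have hX : IsUnit (AdjoinRoot.mk q X) := by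
    have hco : IsCoprime X q := by
      rw [irreducible_X.coprime_iff_not_dvd, X_dvd_iff, coeff_zero_eq_eval_zero]
      exact h 0 le_rfl
    obtain ⟨a, b, hab⟩ := hco
    refine IsUnit.of_mul_eq_one (AdjoinRoot.mk q a) ?_
    rw [← map_mul, ← map_one (AdjoinRoot.mk q), AdjoinRoot.mk_eq_mk]
    exact ⟨-b, by linear_combination hab⟩
  have hnil : IsNilpotent (AdjoinRoot.mk q (p ^ 2 - X)) :=
    ⟨N, by rw [← map_pow, AdjoinRoot.mk_eq_zero]; exact hN⟩
  have hunit : IsUnit (AdjoinRoot.mk q p) := by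
    have h2 := hnil.isUnit_add_left_of_commute hX (Commute.all _ _)
    rw [← map_add, add_sub_cancel, map_pow] at h2
    exact (isUnit_pow_iff two_ne_zero).1 h2
  obtain ⟨r, ⟨-, hr⟩, -⟩ := existsUnique_nilpotent_sub_and_aeval_eq_zero
    (P := (X ^ 2 - C (AdjoinRoot.mk q X) : (AdjoinRoot q)[X])) (x := AdjoinRoot.mk q p)
    (by simpa using hnil)
    (by
      have h2 : IsUnit (2 : AdjoinRoot q) := by
        rw [← map_ofNat (algebraMap ℝ (AdjoinRoot q)) 2]
        exact (IsUnit.mk0 (2 : ℝ) two_ne_zero).map _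
      simpa [one_add_one_eq_two] using h2.mul hunit)
  obtain ⟨g, rfl⟩ := AdjoinRoot.mk_surjective r
  refine ⟨g, ?_⟩
  rw [← AdjoinRoot.mk_eq_zero]
  simpa using hr

/-- A real matrix without eigenvalues in `(-∞, 0]` has a square root which is a polynomial in it. -/
theorem Matrix.exists_aeval_sq_eq {m : Type*} [Fintype m] [DecidableEq m] (Y : Matrix m m ℝ)
    (hY : ∀ t : ℝ, t ≤ 0 → t ∉ spectrum ℝ Y) : ∃ g : ℝ[X], aeval Y g * aeval Y g = Y := by
  obtain ⟨g, d, hd⟩ := Y.charpoly_monic.exists_dvd_sq_sub_X fun t ht h =>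
    hY t ht (Matrix.mem_spectrum_iff_isRoot_charpoly.2 h)
  refine ⟨g, ?_⟩
  have h := congrArg (aeval Y) hd
  rw [map_mul, aeval_self_charpoly, zero_mul, map_sub, map_pow, aeval_X, sub_eq_zero, sq] at h
  exact h

theorem SemiconjBy.aeval_right {R A : Type*} [CommSemiring R] [Semiring A] [Algebra R A]
    {a x y : A} (h : SemiconjBy a x y) (g : R[X]) : SemiconjBy a (aeval x g) (aeval y g) := by
  induction g using Polynomial.induction_on' with
  | add p q hp hq => simpa using hp.add_right hq
  | monomial n c =>
    rw [aeval_monomial, aeval_monomial]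
    exact SemiconjBy.mul_right (Algebra.commutes c a).symm (h.pow_right n)

theorem symplJ_mul_self (n : ℕ) : symplJ n * symplJ n = -1 := by
  rw [symplJ, fromBlocks_multiply, ← fromBlocks_one, fromBlocks_neg]
  simp

theorem transpose_symplJ (n : ℕ) : (symplJ n)ᵀ = -symplJ n := by
  rw [symplJ, fromBlocks_transpose, fromBlocks_neg]
  simp

/-- Theorem 2: if `Y = -X*J*X^T*J` has no real eigenvalue `t ≤ 0`, then `X = M * S` with `M` skew-Hamiltonian, `M * M = Y`, and `S` symplectic. -/
theorem stmt_5 (n : ℕ) (X : Matrix (Fin n ⊕ Fin n) (Fin n ⊕ Fin n) ℝ)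
    (hY : ∀ t : ℝ, t ≤ 0 → t ∉ spectrum ℝ (-(X * symplJ n * Xᵀ * symplJ n))) :
    ∃ M S : Matrix (Fin n ⊕ Fin n) (Fin n ⊕ Fin n) ℝ,
      (symplJ n * M)ᵀ = -(symplJ n * M) ∧
      M * M = -(X * symplJ n * Xᵀ * symplJ n) ∧
      S * symplJ n * Sᵀ = symplJ n ∧ X = M * S := by
  obtain ⟨g, hg⟩ := Matrix.exists_aeval_sq_eq _ hY
  set J := symplJ n with hJ
  have hJJ : J * J = -1 := symplJ_mul_self n
  have hJT : Jᵀ = -J := transpose_symplJ n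
  set Y := -(X * J * Xᵀ * J) with hYdef
  set M := aeval Y g with hM
  have hYunit : IsUnit Y := by
    simpa [spectrum.zero_mem_iff] using hY 0 le_rfl
  have hMunit : IsUnit M.det := by
    rw [← isUnit_iff_isUnit_det]
    rw [← hg, ← sq] at hYunit
    exact (isUnit_pow_iff two_ne_zero).1 hYunit
  have hYJ : SemiconjBy J Y Yᵀ := by
    simp [SemiconjBy, hYdef, transpose_mul, hJT, Matrix.mul_assoc]
  have hMJ : J * M = Mᵀ * J := by
    have h := hYJ.aeval_right g
    rwa [Matrix.aeval_transpose] at h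
  have hYJ' : X * J * Xᵀ = Y * J := by
    rw [hYdef, Matrix.neg_mul, Matrix.mul_assoc _ J J, hJJ]
    simp
  have hJMT : M * J = J * Mᵀ := by
    calc M * J = -(J * J) * (M * J) := by rw [hJJ]; simp
      _ = -(J * (J * M) * J) := by noncomm_ring
      _ = -(J * Mᵀ * (J * J)) := by rw [hMJ]; noncomm_ring
      _ = J * Mᵀ := by rw [hJJ]; simp
  refine ⟨M, M⁻¹ * X, ?_, hg, ?_, (mul_nonsing_inv_cancel_left _ _ hMunit).symm⟩
  · rw [transpose_mul, hJT, hMJ, Matrix.mul_neg]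
  · have hMTunit : IsUnit Mᵀ.det := by rwa [det_transpose]
    calc M⁻¹ * X * J * (M⁻¹ * X)ᵀ = M⁻¹ * (X * J * Xᵀ) * (Mᵀ)⁻¹ := by
          rw [transpose_mul, transpose_nonsing_inv]; simp only [Matrix.mul_assoc]
      _ = M⁻¹ * (M * (M * J)) * (Mᵀ)⁻¹ := by rw [hYJ', ← hg, Matrix.mul_assoc M M J]
      _ = J := by
          rw [nonsing_inv_mul_cancel_left _ _ hMunit, hJMT,
            mul_nonsing_inv_cancel_right _ _ hMTunit]
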